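/- arXiv:1410.6018 — 2 statements merged into one kernel-verified Lean document; each statement's English description precedes it below -/
import Mathlib

section
/- For every n ≥ 0 and every integer a with 0 ≤ a < p^n, one has Σ_{b=0}^{p−1} δ_{n+1}(a + b·p^n) = −k_n(i) − 1 if a ≥ T_n, and Σ_{b=0}^{p−1} δ_{n+1}(a + b·p^n) = −k_n(i) if a < T_n. -/
theorem sum_range_ite_le_neg_one (p d : ℕ) (hd : d ≤ p) :
    ∑ b ∈ Finset.range p, (if d ≤ b then (-1 : ℤ) else 0) = (d : ℤ) - p := by
  induction p, hd using Nat.le_induction with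
  | base =>
    rw [Finset.sum_eq_zero, sub_self]
    intro b hb
    rw [if_neg (by simpa using hb)]
  | succ p hd ih =>
    rw [Finset.sum_range_succ, ih, if_pos hd]
    push_cast
    ring

/-- A number `1 + Σ d α * p ^ α` with digits `d α` in `[0, p - 1]` lies in `[1, p ^ n]`. -/
theorem one_add_sum_digits_mem_Icc (p : ℤ) (d : ℕ → ℤ) (hd : ∀ n, 0 ≤ d n ∧ d n ≤ p - 1) (n : ℕ) :
    1 + ∑ α ∈ Finset.range n, d α * p ^ α ∈ Set.Icc 1 (p ^ n) := by
  have hp : 0 ≤ p := by linarith [hd 0]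
  induction n with
  | zero => simp
  | succ n ih =>
    have hpn : 0 ≤ p ^ n := pow_nonneg hp n
    have hlo := mul_nonneg (hd n).1 hpn
    have hhi := mul_le_mul_of_nonneg_right (hd n).2 hpn
    rw [Set.mem_Icc] at ih ⊢
    rw [Finset.sum_range_succ, pow_succ]
    constructor <;> linarith

theorem add_mul_le_add_mul_iff {a t q b d : ℤ} (ha : 0 ≤ a) (haq : a < q) (ht : 1 ≤ t)
    (htq : t ≤ q) :
    t + d * q ≤ a + b * q ↔ (if t ≤ a then d else d + 1) ≤ b := by
  split_ifs with h
  · constructor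
    · intro hle
      by_contra! hb
      nlinarith [mul_le_mul_of_nonneg_right (Int.add_one_le_of_lt hb) (ha.trans haq.le)]
    · intro hb
      nlinarith [mul_le_mul_of_nonneg_right hb (ha.trans haq.le)]
  · constructor
    · intro hle
      by_contra! hb
      nlinarith [mul_le_mul_of_nonneg_right (Int.le_of_lt_add_one hb) (ha.trans haq.le)]
    · intro hb
      nlinarith [mul_le_mul_of_nonneg_right hb (ha.trans haq.le)]


/-- For every `n ≥ 0` and every integer `a` with `0 ≤ a < p^n`, one has
`Σ_{b=0}^{p−1} δ_{n+1}(a + b·p^n) = −k_n(i) − 1` if `a ≥ T_n`, and `= −k_n(i)` if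
`a < T_n`. -/
theorem stmt_7 (p : ℕ) (hp : p.Prime) (m i : ℕ) (hm : 1 < m) (hpm : ¬ p ∣ m)
    (hi : 0 < i) (him : i < m)
    (r : ℕ → ℕ) (hr : ∀ n : ℕ, r n < m ∧ (m : ℤ) ∣ (p : ℤ) ^ n * (r n : ℤ) - (i : ℤ))
    (k : ℕ → ℤ) (hk : ∀ n : ℕ, (m : ℤ) * k n = (p : ℤ) * (r (n + 1) : ℤ) - (r n : ℤ))
    (hk' : ∀ n : ℕ, 0 ≤ k n ∧ k n ≤ (p : ℤ) - 1)
    (T : ℕ → ℤ)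
    (hT : ∀ n : ℕ, T n = 1 + ∑ α ∈ Finset.range n, ((p : ℤ) - 1 - k α) * (p : ℤ) ^ α)
    (δ : ℕ → ℕ → ℤ) (hδ : ∀ n a : ℕ, δ n a = if T n ≤ (a : ℤ) then -1 else 0) :
    ∀ n : ℕ, ∀ a : ℕ, a < p ^ n →
      ∑ b ∈ Finset.range p, δ (n + 1) (a + b * p ^ n) =
        if T n ≤ (a : ℤ) then -k n - 1 else -k n := by
  intro n a ha
  have hTn : T n ∈ Set.Icc 1 ((p : ℤ) ^ n) := by
    rw [hT]
    exact one_add_sum_digits_mem_Icc p (fun α => (p : ℤ) - 1 - k α)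
      (fun α => by have := hk' α; constructor <;> linarith) n
  have hsucc : T (n + 1) = T n + ((p : ℤ) - 1 - k n) * (p : ℤ) ^ n := by
    rw [hT, hT, Finset.sum_range_succ, add_assoc]
  obtain ⟨d, hd⟩ : ∃ d : ℕ, (d : ℤ) = (p : ℤ) - 1 - k n :=
    ⟨((p : ℤ) - 1 - k n).toNat, Int.toNat_of_nonneg (by linarith [(hk' n).2])⟩
  have hk0 := (hk' n).1
  have key : ∀ b : ℕ, δ (n + 1) (a + b * p ^ n) =
      if (if T n ≤ (a : ℤ) then d else d + 1) ≤ b then -1 else 0 := by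
    intro b
    rw [hδ, hsucc, ← hd]
    refine if_congr ?_ rfl rfl
    push_cast
    rw [add_mul_le_add_mul_iff (by positivity) (by exact_mod_cast ha) hTn.1 hTn.2]
    split_ifs <;> norm_cast
  rw [Finset.sum_congr rfl fun b _ => key b, sum_range_ite_le_neg_one _ _ (by split_ifs <;> omega)]
  split_ifs <;> push_cast <;> linarith
end

section
/- Let ω : ℤ_p^× → ℤ_p be the unique function such that ω(u)^{p−1} = 1 and ω(u) ≡ u (mod p) for every unit u (the Teichmüller character; here p is odd). Let k ≥ 1 and b ≥ 0 be integers with k ≡ b (mod p−1). Then the sequence n ↦ Σ_{0 ≤ α < p^n, p ∤ α} (α·ω(α)^{−1})^k · α^{−1} · ω(α)^b · μ_n(α) converges in ℚ_p to (1/k)·(B_k(i/m) − B_k) − (p^{k−1}/k)·(B_k(r_1/m) − B_k). (In particular, the interpolating function H̃_p(1−s, ω^b, i/m) := ∫_{ℤ_p^×} [x]^s x^{−1} ω(x)^b dμ(i/m)(x) takes this value at s = k.) -/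
open Polynomial in
theorem sum_range_pow_eq_bernoulli_div (d n : ℕ) (F : Type*) [Field F] [CharZero F] :
    ∑ a ∈ Finset.range n, (a : F) ^ d =
      (aeval (n : F) (Polynomial.bernoulli (d + 1)) - (_root_.bernoulli (d + 1) : F)) /
        (d + 1) := by
  have h := congrArg (algebraMap ℚ F) (sum_range_pow_eq_bernoulli_sub n d)
  have hd : (d + 1 : F) ≠ 0 := by exact_mod_cast d.succ_ne_zero
  have h2 : (algebraMap ℚ F) (eval (n : ℚ) (Polynomial.bernoulli (d + 1))) =
      aeval (n : F) (Polynomial.bernoulli (d + 1)) := by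
    rw [← aeval_algebraMap_apply_eq_algebraMap_eval, map_natCast]
  rw [Nat.succ_eq_add_one, map_sub, h2] at h
  rw [eq_div_iff hd, mul_comm]
  simpa using h

/-- The shifted digits `p - 1 - k α` add up to the distance from `p ^ n - 1` to the sum of the
`k α * p ^ α`, which telescopes. -/
theorem mul_pow_sub_digit_sum (p m : ℤ) (r k T : ℕ → ℤ)
    (hk : ∀ n, m * k n = p * r (n + 1) - r n)
    (hT : ∀ n, T n = 1 + ∑ α ∈ Finset.range n, (p - 1 - k α) * p ^ α) (n : ℕ) :
    m * (p ^ n - T n) = p ^ n * r n - r 0 := by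
  induction n with
  | zero => simp [hT]
  | succ n ih =>
    have h : T (n + 1) = T n + (p - 1 - k n) * p ^ n := by
      rw [hT, hT, Finset.sum_range_succ, add_assoc]
    rw [h]
    linear_combination ih + p ^ n * hk n

theorem tendsto_sum_pow_mul_measure (p : ℕ) [Fact p.Prime] (m : ℕ) (hm : m ≠ 0)
    (r : ℕ → ℕ) (k T : ℕ → ℤ)
    (hk : ∀ n, (m : ℤ) * k n = (p : ℤ) * (r (n + 1) : ℤ) - (r n : ℤ))
    (hk' : ∀ n, 0 ≤ k n ∧ k n ≤ (p : ℤ) - 1)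
    (hT : ∀ n, T n = 1 + ∑ α ∈ Finset.range n, ((p : ℤ) - 1 - k α) * (p : ℤ) ^ α) (d : ℕ) :
    Filter.Tendsto
      (fun n : ℕ => ∑ a ∈ Finset.range (p ^ n), (a : ℚ_[p]) ^ d *
        ((r n : ℚ_[p]) * (m : ℚ_[p])⁻¹ + if T n ≤ (a : ℤ) then -1 else 0))
      Filter.atTop
      (nhds ((Polynomial.aeval ((r 0 : ℚ_[p]) / m) (Polynomial.bernoulli (d + 1))
        - (bernoulli (d + 1) : ℚ_[p])) / (d + 1))) := by
  have hm' : (m : ℚ_[p]) ≠ 0 := by exact_mod_cast hm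
  have hdist := mul_pow_sub_digit_sum p m (fun n => r n) k T hk hT
  have hT0 : ∀ n, 0 ≤ T n := fun n => by
    rw [hT]
    have : 0 ≤ ∑ α ∈ Finset.range n, ((p : ℤ) - 1 - k α) * (p : ℤ) ^ α :=
      Finset.sum_nonneg fun α _ => mul_nonneg (by linarith [(hk' α).2]) (by positivity)
    linarith
  have hTle : ∀ n, T n ≤ (p : ℤ) ^ n := fun n => by
    have h : T n + ∑ α ∈ Finset.range n, k α * (p : ℤ) ^ α = (p : ℤ) ^ n := by
      rw [hT, add_assoc, ← Finset.sum_add_distrib]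
      have := mul_geom_sum (p : ℤ) n
      rw [Finset.mul_sum] at this
      rw [← eq_sub_iff_add_eq', ← this]
      exact Finset.sum_congr rfl fun _ _ => by ring
    have : 0 ≤ ∑ α ∈ Finset.range n, k α * (p : ℤ) ^ α :=
      Finset.sum_nonneg fun α _ => mul_nonneg (hk' α).1 (by positivity)
    linarith
  have hpn : Filter.Tendsto (fun n : ℕ => (p : ℚ_[p]) ^ n) Filter.atTop (nhds 0) :=
    tendsto_pow_atTop_nhds_zero_of_norm_lt_one Padic.norm_p_lt_one
  have hrpn : Filter.Tendsto (fun n : ℕ => (p : ℚ_[p]) ^ n * (r n : ℚ_[p])) Filter.atTop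
      (nhds 0) := by
    refine squeeze_zero_norm (fun n => ?_) (by simpa using hpn.norm)
    rw [norm_mul]
    exact (mul_le_of_le_one_right (norm_nonneg _)
      (by simpa using Padic.norm_int_le_one (p := p) (r n : ℤ))).trans_eq (by simp)
  have hTeq : ∀ n, (T n : ℚ_[p]) = p ^ n - (p ^ n * r n - r 0) / m := fun n => by
    have h : (m : ℚ_[p]) * (p ^ n - T n) = p ^ n * r n - r 0 := by exact_mod_cast hdist n
    field_simp
    linear_combination -h
  have hTlim : Filter.Tendsto (fun n : ℕ => (T n : ℚ_[p])) Filter.atTop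
      (nhds ((r 0 : ℚ_[p]) / m)) := by
    simp_rw [hTeq]
    convert hpn.sub ((hrpn.sub_const (r 0 : ℚ_[p])).div_const (m : ℚ_[p])) using 2
    ring
  set P : ℚ_[p] → ℚ_[p] := fun x => Polynomial.aeval x (Polynomial.bernoulli (d + 1)) with hP
  have hPc : Continuous P := Polynomial.continuous_aeval _
  have hP0 : P 0 = (bernoulli (d + 1) : ℚ_[p]) := by
    have := sum_range_pow_eq_bernoulli_div d 0 ℚ_[p]
    have hd : (d + 1 : ℚ_[p]) ≠ 0 := by exact_mod_cast d.succ_ne_zero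
    simp only [Finset.range_zero, Finset.sum_empty, Nat.cast_zero] at this
    rw [eq_comm, div_eq_zero_iff, or_iff_left hd, sub_eq_zero] at this
    exact this
  have hsum : ∀ n : ℕ, ∑ a ∈ Finset.range n, (a : ℚ_[p]) ^ d = (P n - P 0) / (d + 1) :=
    fun n => by rw [sum_range_pow_eq_bernoulli_div, hP0]
  have key : ∀ n : ℕ, ∑ a ∈ Finset.range (p ^ n), (a : ℚ_[p]) ^ d *
        ((r n : ℚ_[p]) * (m : ℚ_[p])⁻¹ + if T n ≤ (a : ℤ) then -1 else 0) =
      (r n : ℚ_[p]) * ((m : ℚ_[p])⁻¹ * ((P (p ^ n) - P 0) / (d + 1))) +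
        (P (T n) - P (p ^ n)) / (d + 1) := fun n => by
    obtain ⟨t, ht⟩ := Int.eq_ofNat_of_zero_le (hT0 n)
    have htle : t ≤ p ^ n := by
      have := hTle n
      rw [ht] at this
      exact_mod_cast this
    have hcut : ∑ a ∈ Finset.range (p ^ n),
        (a : ℚ_[p]) ^ d * (if T n ≤ (a : ℤ) then (-1 : ℚ_[p]) else 0) =
          ∑ a ∈ Finset.range t, (a : ℚ_[p]) ^ d - ∑ a ∈ Finset.range (p ^ n), (a : ℚ_[p]) ^ d := by
      rw [← Finset.sum_range_add_sum_Ico _ htle, ← Finset.sum_range_add_sum_Ico _ htle,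
        Finset.sum_eq_zero, ← sub_sub, sub_self, zero_add, zero_sub, ← Finset.sum_neg_distrib]
      · refine Finset.sum_congr rfl fun a ha => ?_
        rw [if_pos (by rw [ht]; exact_mod_cast (Finset.mem_Ico.1 ha).1), mul_neg_one]
      · intro a ha
        have := Finset.mem_range.1 ha
        rw [if_neg (by rw [ht]; push Not; exact_mod_cast this), mul_zero]
    simp_rw [mul_add]
    rw [Finset.sum_add_distrib, hcut, ← Finset.sum_mul, hsum, hsum, ht]
    push_cast
    ring
  simp_rw [key, ← hP0]
  have hPp : Filter.Tendsto (fun n : ℕ => P ((p : ℚ_[p]) ^ n)) Filter.atTop (nhds (P 0)) :=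
    (hPc.tendsto 0).comp hpn
  have hPT := (hPc.tendsto _).comp hTlim
  have h1 : Filter.Tendsto (fun n : ℕ => (r n : ℚ_[p]) *
      ((m : ℚ_[p])⁻¹ * ((P (p ^ n) - P 0) / (d + 1)))) Filter.atTop (nhds 0) := by
    have h2 : Filter.Tendsto (fun n : ℕ => (m : ℚ_[p])⁻¹ * ((P (p ^ n) - P 0) / (d + 1)))
        Filter.atTop (nhds 0) := by
      simpa using ((hPp.sub_const (P 0)).div_const (d + 1 : ℚ_[p])).const_mul (m : ℚ_[p])⁻¹
    refine squeeze_zero_norm (fun n => ?_) (by simpa using h2.norm)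
    rw [norm_mul]
    exact (mul_le_of_le_one_left (norm_nonneg _)
      (by simpa using Padic.norm_int_le_one (p := p) (r n : ℤ))).trans_eq (by simp)
  simpa using h1.add ((hPT.sub hPp).div_const (d + 1 : ℚ_[p]))

theorem sum_range_filter_dvd {M : Type*} [AddCommMonoid M] (p N : ℕ) (hp : 0 < p) (f : ℕ → M) :
    ∑ a ∈ (Finset.range (p * N)).filter (fun a => p ∣ a), f a =
      ∑ a ∈ Finset.range N, f (p * a) := by
  symm
  refine Finset.sum_bij (fun a _ => p * a) ?_ ?_ ?_ (fun _ _ => rfl)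
  · intro a ha
    simp only [Finset.mem_filter, Finset.mem_range] at ha ⊢
    exact ⟨Nat.mul_lt_mul_of_pos_left ha hp, dvd_mul_right _ _⟩
  · intro a _ b _ h
    exact Nat.eq_of_mul_eq_mul_left hp h
  · intro a ha
    simp only [Finset.mem_filter, Finset.mem_range] at ha
    obtain ⟨h, c, rfl⟩ := ha
    exact ⟨c, Finset.mem_range.2 (Nat.lt_of_mul_lt_mul_left h), rfl⟩


/-- (`p` odd.) Let `ω` be the Teichmüller character, i.e. the unique
function on units of `ℤ_p` with `ω(u)^{p−1} = 1` and `ω(u) ≡ u (mod p)`. Let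
`k ≥ 1`, `b ≥ 0` with `k ≡ b (mod p−1)`. Then the sequence
`n ↦ Σ_{0 ≤ α < p^n, p ∤ α} (α·ω(α)⁻¹)^k·α⁻¹·ω(α)^b·μ_n(α)` converges in `ℚ_p` to
`(1/k)·(B_k(i/m) − B_k) − (p^{k−1}/k)·(B_k(r_1/m) − B_k)`. (This is the value at
`s = k` of `H̃_p(1−s, ω^b, i/m) = ∫_{ℤ_p^×} [x]^s x⁻¹ ω(x)^b dμ(i/m)(x)`.) -/
theorem stmt_14 (p : ℕ) [Fact p.Prime] (hp2 : p ≠ 2)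
    (m i : ℕ) (hm : 1 < m) (hpm : ¬ p ∣ m)
    (hi : 0 < i) (him : i < m)
    (r : ℕ → ℕ) (hr : ∀ n : ℕ, r n < m ∧ (m : ℤ) ∣ (p : ℤ) ^ n * (r n : ℤ) - (i : ℤ))
    (k : ℕ → ℤ) (hk : ∀ n : ℕ, (m : ℤ) * k n = (p : ℤ) * (r (n + 1) : ℤ) - (r n : ℤ))
    (hk' : ∀ n : ℕ, 0 ≤ k n ∧ k n ≤ (p : ℤ) - 1)
    (minv : ℤ_[p]) (hminv : (m : ℤ_[p]) * minv = 1)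
    (T : ℕ → ℤ)
    (hT : ∀ n : ℕ, T n = 1 + ∑ α ∈ Finset.range n, ((p : ℤ) - 1 - k α) * (p : ℤ) ^ α)
    (δ : ℕ → ℕ → ℤ) (hδ : ∀ n a : ℕ, δ n a = if T n ≤ (a : ℤ) then -1 else 0)
    (μ : ℕ → ℕ → ℤ_[p])
    (hμ : ∀ n a : ℕ, μ n a = (r n : ℤ_[p]) * minv + (δ n a : ℤ_[p]))
    (ω : ℤ_[p] → ℤ_[p])
    (hω : ∀ x : ℤ_[p], IsUnit x → ω x ^ (p - 1) = 1 ∧ (p : ℤ_[p]) ∣ ω x - x)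
    (hωuniq : ∀ ω' : ℤ_[p] → ℤ_[p],
      (∀ x : ℤ_[p], IsUnit x → ω' x ^ (p - 1) = 1 ∧ (p : ℤ_[p]) ∣ ω' x - x) →
      ∀ x : ℤ_[p], IsUnit x → ω' x = ω x)
    (K b : ℕ) (hK : 1 ≤ K) (hKb : K ≡ b [MOD p - 1]) :
    Filter.Tendsto
      (fun n : ℕ => ∑ α ∈ (Finset.range (p ^ n)).filter (fun α => ¬ p ∣ α),
        ((α : ℚ_[p]) * ((ω (α : ℤ_[p]) : ℚ_[p]))⁻¹) ^ K * (α : ℚ_[p])⁻¹ *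
          ((ω (α : ℤ_[p]) : ℚ_[p])) ^ b * (μ n α : ℚ_[p]))
      Filter.atTop
      (nhds ((((1 / (K : ℚ)) *
          (Polynomial.eval ((i : ℚ) / (m : ℚ)) (Polynomial.bernoulli K)
            - bernoulli K)
        - ((p : ℚ) ^ (K - 1) / (K : ℚ)) *
          (Polynomial.eval ((r 1 : ℚ) / (m : ℚ)) (Polynomial.bernoulli K)
            - bernoulli K) : ℚ) : ℚ_[p]))) := by
  have hp : p.Prime := Fact.out
  have hp0 : (0 : ℤ) < p := by exact_mod_cast hp.pos
  have hr0 : r 0 = i := by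
    obtain ⟨h1, h2⟩ := hr 0
    have := Int.eq_zero_of_abs_lt_dvd h2 (by rw [abs_lt]; constructor <;> simp <;> omega)
    simp at this
    omega
  have hminv' : (minv : ℚ_[p]) = (m : ℚ_[p])⁻¹ := by
    have := congrArg (fun x : ℤ_[p] => (x : ℚ_[p])) hminv
    push_cast at this
    exact eq_inv_of_mul_eq_one_right this
  obtain ⟨d, rfl⟩ : ∃ d, K = d + 1 := ⟨K - 1, by omega⟩
  have hterm : ∀ n α : ℕ, ¬ p ∣ α →
      ((α : ℚ_[p]) * ((ω (α : ℤ_[p]) : ℚ_[p]))⁻¹) ^ (d + 1) * (α : ℚ_[p])⁻¹ *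
          ((ω (α : ℤ_[p]) : ℚ_[p])) ^ b * (μ n α : ℚ_[p]) =
        (α : ℚ_[p]) ^ d * ((r n : ℚ_[p]) * (m : ℚ_[p])⁻¹ + if T n ≤ (α : ℤ) then -1 else 0) := by
    intro n α hα
    have hu : IsUnit (α : ℤ_[p]) := by
      rw [PadicInt.isUnit_iff, PadicInt.norm_natCast_eq_one_iff]
      exact (Nat.Prime.coprime_iff_not_dvd hp).2 hα
    have hα0 : (α : ℚ_[p]) ≠ 0 := by
      rintro h
      exact hα (by rw [Nat.cast_eq_zero.1 h]; exact dvd_zero p)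
    have hw : (ω (α : ℤ_[p]) : ℚ_[p]) ^ (p - 1) = 1 := by
      rw [← PadicInt.coe_pow, (hω _ hu).1, PadicInt.coe_one]
    have hw0 : (ω (α : ℤ_[p]) : ℚ_[p]) ≠ 0 := by
      rintro h
      rw [h, zero_pow (by have := hp.two_le; omega)] at hw
      exact zero_ne_one hw
    rw [← pow_eq_pow_of_modEq hKb hw, hμ, hδ]
    push_cast
    rw [hminv', mul_pow, inv_pow, pow_succ (α : ℚ_[p])]
    split_ifs <;> push_cast <;> field_simp
  have hlim := tendsto_sum_pow_mul_measure p m (by omega) r k T hk hk' hT d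
  set T' : ℕ → ℤ := fun n =>
    1 + ∑ α ∈ Finset.range n, ((p : ℤ) - 1 - k (α + 1)) * (p : ℤ) ^ α with hT'
  have hlim' := tendsto_sum_pow_mul_measure p m (by omega) (fun n => r (n + 1))
    (fun n => k (n + 1)) T' (fun n => hk (n + 1)) (fun n => hk' (n + 1)) (fun n => rfl) d
  have hTT : ∀ n, T (n + 1) = 1 + (p - 1 - k 0) + p * (T' n - 1) := fun n => by
    rw [hT, Finset.sum_range_succ', hT']
    simp only [add_sub_cancel_left, Finset.mul_sum]
    rw [pow_zero, mul_one, add_comm (∑ _ ∈ _, _), add_assoc]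
    congr 2
    exact Finset.sum_congr rfl fun _ _ => by ring
  have hcmp : ∀ (n β : ℕ), T (n + 1) ≤ ((p * β : ℕ) : ℤ) ↔ T' n ≤ (β : ℤ) := by
    intro n β
    rw [hTT]
    obtain ⟨h1, h2⟩ := hk' 0
    push_cast
    constructor
    · intro h
      by_contra! hlt
      nlinarith
    · intro h
      nlinarith
  rw [← Filter.tendsto_add_atTop_iff_nat 1]
  refine (((Filter.tendsto_add_atTop_iff_nat 1).2 hlim).sub
    (hlim'.const_mul ((p : ℚ_[p]) ^ d))).congr' (Filter.Eventually.of_forall fun n => ?_) |>.trans ?_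
  · rw [Finset.sum_congr rfl fun α hα => hterm (n + 1) α (Finset.mem_filter.1 hα).2,
      sub_eq_iff_eq_add', ← Finset.sum_filter_add_sum_filter_not _ (fun α => p ∣ α)]
    congr 1
    rw [pow_succ' p n, sum_range_filter_dvd p _ hp.pos, Finset.mul_sum]
    refine Finset.sum_congr rfl fun β _ => ?_
    simp only [hcmp]
    push_cast
    ring
  · refine le_of_eq (congrArg nhds ?_)
    have haeval : ∀ j : ℕ, (Polynomial.aeval ((j : ℚ_[p]) / m) (Polynomial.bernoulli (d + 1))) =
        ((Polynomial.eval ((j : ℚ) / (m : ℚ)) (Polynomial.bernoulli (d + 1)) : ℚ) : ℚ_[p]) := by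
      intro j
      have := Polynomial.aeval_algebraMap_apply_eq_algebraMap_eval (A := ℚ_[p]) ((j : ℚ) / (m : ℚ))
        (Polynomial.bernoulli (d + 1))
      simpa using this
    rw [haeval, haeval, hr0]
    push_cast
    ring
end
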